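/- For real x and 0 < δ ≤ η define ζ(x) := ∫_x^∞ v^{−1}·(v−x)^{−1/2}·1_{δ ≤ |v| ≤ η} dv. Then: (i) if x > η, ζ(x) = 0; (ii) if δ ≤ x ≤ η, | ζ(x) − π·x^{−1/2} | ≤ π·η^{−1/2}; (iii) if −δ ≤ x ≤ δ, | ζ(x) | ≤ π·δ^{−1/2}; (iv) if x ≤ −η, | ζ(x) | ≤ log(3 + 2√2)·η^{−1/2}. -/

import Mathlib

open MeasureTheory

/-- The arctangent primitive of `1 / (v √(v - a))` for `v > a > 0`. -/
lemma hasDerivAt_arctan_sqrt_sub {a v : ℝ} (ha : 0 < a) (hv : a < v) :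
    HasDerivAt (fun v => 2 / √a * Real.arctan (√(v - a) / √a)) (v * √(v - a))⁻¹ v := by
  have hva : 0 < v - a := sub_pos.2 hv
  have hs : 0 < √(v - a) := Real.sqrt_pos.2 hva
  have hsa : 0 < √a := Real.sqrt_pos.2 ha
  have h := ((((hasDerivAt_id v).sub_const a).sqrt hva.ne').div_const √a).arctan.const_mul (2 / √a)
  refine h.congr_deriv ?_
  have h1 : √(v - a) ^ 2 = v - a := Real.sq_sqrt hva.le
  have h2 : √a ^ 2 = a := Real.sq_sqrt ha.le
  have h3 : 1 + (√(v - a) / √a) ^ 2 = v / √a ^ 2 := by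
    rw [div_pow, h1, h2]; field_simp; ring
  have hv0 : 0 < v := ha.trans hv
  simp only [id]
  rw [h3]
  field_simp

lemma continuous_arctan_sqrt_sub (a : ℝ) :
    Continuous fun v => 2 / √a * Real.arctan (√(v - a) / √a) := by
  have := Real.continuous_arctan
  fun_prop

lemma intervalIntegrable_inv_mul_sqrt_sub {a b : ℝ} (ha : 0 < a) (hab : a ≤ b) :
    IntervalIntegrable (fun v => (v * √(v - a))⁻¹) volume a b := by
  rw [intervalIntegrable_iff_integrableOn_Ioc_of_le hab]
  refine intervalIntegral.integrableOn_deriv_of_nonneg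
    (continuous_arctan_sqrt_sub a).continuousOn
    (fun v hv => hasDerivAt_arctan_sqrt_sub ha hv.1) fun v hv => ?_
  have := ha.trans hv.1
  positivity

lemma integral_inv_mul_sqrt_sub {a b : ℝ} (ha : 0 < a) (hab : a ≤ b) :
    ∫ v in a..b, (v * √(v - a))⁻¹ = 2 / √a * Real.arctan (√(b - a) / √a) := by
  rw [intervalIntegral.integral_eq_sub_of_hasDerivAt_of_le hab
    (continuous_arctan_sqrt_sub a).continuousOn
    (fun v hv => hasDerivAt_arctan_sqrt_sub ha hv.1) (intervalIntegrable_inv_mul_sqrt_sub ha hab)]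
  simp

/-- The logarithmic primitive of `1 / (w √(y - w))` for `0 < w < y`. -/
lemma hasDerivAt_log_sqrt_sub {y w : ℝ} (hw : 0 < w) (hwy : w < y) :
    HasDerivAt (fun w => (Real.log (√y - √(y - w)) - Real.log (√y + √(y - w))) / √y)
      (w * √(y - w))⁻¹ w := by
  have hyw : 0 < y - w := sub_pos.2 hwy
  have hs : 0 < √(y - w) := Real.sqrt_pos.2 hyw
  have hy : 0 < √y := Real.sqrt_pos.2 (hw.trans hwy)
  have hlt : 0 < √y - √(y - w) := sub_pos.2 (Real.sqrt_lt_sqrt hyw.le (by linarith))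
  have hd := ((hasDerivAt_id w).const_sub y).sqrt hyw.ne'
  have h := (((hd.const_sub √y).log hlt.ne').sub
    ((hd.const_add √y).log (by simp only [id]; positivity))).div_const √y
  refine h.congr_deriv ?_
  simp only [id]
  have h1 : w = (√y - √(y - w)) * (√y + √(y - w)) := by
    ring_nf
    rw [Real.sq_sqrt hyw.le, Real.sq_sqrt (hw.trans hwy).le]; ring
  generalize √(y - w) = s at *
  rw [h1]
  have : 0 < √y + s := by positivity
  field_simp
  ring

/-- The logarithmic primitive of `1 / (w √(y + w))` for `w, y > 0`. -/
lemma hasDerivAt_log_sqrt_add {y w : ℝ} (hw : 0 < w) (hy : 0 < y) :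
    HasDerivAt (fun w => (Real.log (√(y + w) - √y) - Real.log (√(y + w) + √y)) / √y)
      (w * √(y + w))⁻¹ w := by
  have hyw : 0 < y + w := by positivity
  have hs : 0 < √(y + w) := Real.sqrt_pos.2 hyw
  have hy' : 0 < √y := Real.sqrt_pos.2 hy
  have hlt : 0 < √(y + w) - √y := sub_pos.2 (Real.sqrt_lt_sqrt hy.le (by linarith))
  have hd := ((hasDerivAt_id w).const_add y).sqrt hyw.ne'
  have h := (((hd.sub_const √y).log hlt.ne').sub
    ((hd.add_const √y).log (by simp only [id]; positivity))).div_const √y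
  refine h.congr_deriv ?_
  simp only [id]
  have h1 : w = (√(y + w) - √y) * (√(y + w) + √y) := by
    ring_nf
    rw [Real.sq_sqrt hyw.le, Real.sq_sqrt hy.le]; ring
  generalize √(y + w) = s at *
  rw [h1]
  have : 0 < s + √y := by positivity
  field_simp
  ring

lemma continuousOn_log_sqrt_sub {a b y : ℝ} (ha : 0 < a) (hby : b ≤ y) :
    ContinuousOn (fun w => (Real.log (√y - √(y - w)) - Real.log (√y + √(y - w))) / √y)
      (Set.Icc a b) := by
  have hpos : ∀ w ∈ Set.Icc a b, 0 < √y - √(y - w) := fun w hw =>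
    sub_pos.2 (Real.sqrt_lt_sqrt (by linarith [hw.2]) (by linarith [hw.1]))
  refine ContinuousOn.div_const (ContinuousOn.sub ?_ ?_) _
  · exact ContinuousOn.log (by fun_prop) fun w hw => (hpos w hw).ne'
  · refine ContinuousOn.log (by fun_prop) fun w hw => ?_
    have := hpos w hw
    have := Real.sqrt_nonneg (y - w)
    linarith

lemma continuousOn_log_sqrt_add {a b y : ℝ} (ha : 0 < a) (hy : 0 < y) :
    ContinuousOn (fun w => (Real.log (√(y + w) - √y) - Real.log (√(y + w) + √y)) / √y)
      (Set.Icc a b) := fun _ hw =>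
  (hasDerivAt_log_sqrt_add (ha.trans_le hw.1) hy).continuousAt.continuousWithinAt

lemma intervalIntegrable_inv_mul_sqrt_rev {a b y : ℝ} (ha : 0 < a) (hab : a ≤ b) (hby : b ≤ y) :
    IntervalIntegrable (fun w => (w * √(y - w))⁻¹) volume a b := by
  rw [intervalIntegrable_iff_integrableOn_Ioc_of_le hab]
  refine intervalIntegral.integrableOn_deriv_of_nonneg (continuousOn_log_sqrt_sub ha hby)
    (fun v hv => hasDerivAt_log_sqrt_sub (ha.trans hv.1) (hv.2.trans_le hby)) fun v hv => ?_
  have := ha.trans hv.1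
  positivity

lemma intervalIntegrable_inv_mul_sqrt_add {a b y : ℝ} (ha : 0 < a) (hab : a ≤ b) (hy : 0 < y) :
    IntervalIntegrable (fun w => (w * √(y + w))⁻¹) volume a b := by
  rw [intervalIntegrable_iff_integrableOn_Ioc_of_le hab]
  refine intervalIntegral.integrableOn_deriv_of_nonneg (continuousOn_log_sqrt_add ha hy)
    (fun v hv => hasDerivAt_log_sqrt_add (ha.trans hv.1) hy) fun v hv => ?_
  have := ha.trans hv.1
  positivity

lemma integral_inv_mul_sqrt_rev_sub_add_le {a b : ℝ} (ha : 0 < a) (hab : a ≤ b) :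
    ∫ w in a..b, ((w * √(b - w))⁻¹ - (w * √(b + w))⁻¹) ≤ Real.log (3 + 2 * √2) / √b := by
  have hb : 0 < b := ha.trans_le hab
  rw [intervalIntegral.integral_sub (intervalIntegrable_inv_mul_sqrt_rev ha hab le_rfl)
      (intervalIntegrable_inv_mul_sqrt_add ha hab hb),
    intervalIntegral.integral_eq_sub_of_hasDerivAt_of_le hab (continuousOn_log_sqrt_sub ha le_rfl)
      (fun w hw => hasDerivAt_log_sqrt_sub (ha.trans hw.1) hw.2)
      (intervalIntegrable_inv_mul_sqrt_rev ha hab le_rfl),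
    intervalIntegral.integral_eq_sub_of_hasDerivAt_of_le hab (continuousOn_log_sqrt_add ha hb)
      (fun w hw => hasDerivAt_log_sqrt_add (ha.trans hw.1) hb)
      (intervalIntegrable_inv_mul_sqrt_add ha hab hb),
    ← sub_div, ← sub_div, ← sub_div]
  gcongr
  have hsb : 0 < √b := Real.sqrt_pos.2 hb
  have h2 : (1 : ℝ) < √2 := Real.lt_sqrt_of_sq_lt (by norm_num)
  have hbb : √(b + b) = √2 * √b := by rw [← two_mul, Real.sqrt_mul zero_le_two]
  have hlog : Real.log (3 + 2 * √2) = Real.log (√(b + b) + √b) - Real.log (√(b + b) - √b) := by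
    have hsub : 0 < √2 * √b - √b := by nlinarith
    rw [hbb, ← Real.log_div (by positivity) hsub.ne']
    congr 1
    rw [eq_div_iff hsub.ne']
    have := Real.sq_sqrt (zero_le_two (α := ℝ))
    linear_combination 2 * √b * this
  have hs1 : 0 < √b - √(b - a) :=
    sub_pos.2 (Real.sqrt_lt_sqrt (by linarith) (by linarith))
  have hs2 : 0 < √(b + a) - √b := sub_pos.2 (Real.sqrt_lt_sqrt hb.le (by linarith))
  have hp : √(b - a) * √(b + a) ≤ √b * √b := by
    rw [← Real.sqrt_mul (by linarith), ← Real.sqrt_mul hb.le]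
    exact Real.sqrt_le_sqrt (by nlinarith)
  have hmono : Real.log ((√b + √(b - a)) * (√(b + a) - √b)) ≤
      Real.log ((√b - √(b - a)) * (√(b + a) + √b)) := by
    refine Real.log_le_log (by positivity) ?_
    nlinarith
  rw [Real.log_mul (by positivity) hs2.ne', Real.log_mul hs1.ne' (by positivity)] at hmono
  simp only [sub_self, Real.sqrt_zero, sub_zero, add_zero]
  linarith

lemma inv_sqrt_sub_sub_inv_sqrt_add_eq {y w : ℝ} (hw : 0 < w) (hwy : w < y) :
    (w * √(y - w))⁻¹ - (w * √(y + w))⁻¹ =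
      2 / (√(y - w) * √(y + w) * (√(y - w) + √(y + w))) := by
  have h1 : 0 < √(y - w) := Real.sqrt_pos.2 (by linarith)
  have h2 : 0 < √(y + w) := Real.sqrt_pos.2 (by linarith)
  have e1 : √(y - w) ^ 2 = y - w := Real.sq_sqrt (by linarith)
  have e2 : √(y + w) ^ 2 = y + w := Real.sq_sqrt (by linarith)
  field_simp
  linear_combination e2 - e1

lemma abs_inv_sqrt_add_sub_le {b y w : ℝ} (hw : 0 < w) (hwb : w < b) (hby : b ≤ y) :
    |(w * √(y + w))⁻¹ - (w * √(y - w))⁻¹| ≤ (w * √(b - w))⁻¹ - (w * √(b + w))⁻¹ := by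
  have h1 : 0 < √(b - w) := Real.sqrt_pos.2 (by linarith)
  rw [abs_sub_comm, inv_sqrt_sub_sub_inv_sqrt_add_eq hw hwb,
    inv_sqrt_sub_sub_inv_sqrt_add_eq hw (hwb.trans_le hby), abs_of_nonneg (by positivity)]
  have h2 : 0 < √(b + w) := Real.sqrt_pos.2 (by linarith)
  gcongr

/-- Restricting the truncated integrand to a set agreeing a.e. with the truncation. -/
lemma integral_Ioi_ite_eq {x δ η : ℝ} {f : ℝ → ℝ} {s : Set ℝ}
    (hs : ∀ᵐ v, (v ∈ Set.Ioi x ∧ δ ≤ |v| ∧ |v| ≤ η) ↔ v ∈ s) :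
    (∫ v in Set.Ioi x, if δ ≤ |v| ∧ |v| ≤ η then f v else 0) = ∫ v in s, f v := by
  have hm : MeasurableSet {v : ℝ | δ ≤ |v| ∧ |v| ≤ η} := by measurability
  calc
    _ = ∫ v in Set.Ioi x, Set.indicator {v : ℝ | δ ≤ |v| ∧ |v| ≤ η} f v := by
      simp only [Set.indicator_apply, Set.mem_ofPred_eq]
    _ = ∫ v in Set.Ioi x ∩ {v : ℝ | δ ≤ |v| ∧ |v| ≤ η}, f v := setIntegral_indicator hm
    _ = _ := setIntegral_congr_set (by filter_upwards [hs] with v hv; exact propext hv)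

/-- Jordan's inequality for the complementary angle of `arctan (√(b - a) / √a)`. -/
lemma pi_div_sqrt_sub_arctan_le {a b : ℝ} (ha : 0 < a) (hab : a ≤ b) :
    Real.pi / √a - 2 / √a * Real.arctan (√(b - a) / √a) ≤ Real.pi / √b := by
  have hsa : 0 < √a := Real.sqrt_pos.2 ha
  have hsb : 0 < √b := Real.sqrt_pos.2 (ha.trans_le hab)
  set t := √(b - a) / √a with ht
  have hsq : 1 + t ^ 2 = b / a := by
    rw [ht, div_pow, Real.sq_sqrt (by linarith), Real.sq_sqrt ha.le]
    field_simp; ring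
  have hcos : Real.cos (Real.arctan t) = √a / √b := by
    rw [Real.cos_arctan, hsq, Real.sqrt_div' _ ha.le, one_div_div]
  have ht0 : 0 ≤ Real.arctan t := Real.arctan_nonneg.2 (by positivity)
  have hj := Real.mul_le_sin (x := Real.pi / 2 - Real.arctan t)
    (by linarith [Real.arctan_lt_pi_div_two t]) (by linarith)
  rw [Real.sin_pi_div_two_sub, hcos] at hj
  calc Real.pi / √a - 2 / √a * Real.arctan t
      = Real.pi / √a * (2 / Real.pi * (Real.pi / 2 - Real.arctan t)) := by field_simp
    _ ≤ Real.pi / √a * (√a / √b) := by gcongr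
    _ = Real.pi / √b := by field_simp

/-- Bounds for `ζ(x) = ∫_x^∞ v^{−1}·(v−x)^{−1/2}·1_{δ ≤ |v| ≤ η} dv`:
(i) `ζ(x) = 0` for `x > η`; (ii) `|ζ(x) − π·x^{−1/2}| ≤ π·η^{−1/2}` for `δ ≤ x ≤ η`;
(iii) `|ζ(x)| ≤ π·δ^{−1/2}` for `−δ ≤ x ≤ δ`;
(iv) `|ζ(x)| ≤ log(3+2√2)·η^{−1/2}` for `x ≤ −η`. -/
theorem zeta_bounds (δ η : ℝ) (hδ : 0 < δ) (hδη : δ ≤ η)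
    (ζ : ℝ → ℝ)
    (hζ : ∀ x, ζ x =
      ∫ v in Set.Ioi x, if δ ≤ |v| ∧ |v| ≤ η then (v * Real.sqrt (v - x))⁻¹ else 0) :
    (∀ x : ℝ, η < x → ζ x = 0) ∧
    (∀ x : ℝ, δ ≤ x → x ≤ η → |ζ x - Real.pi / Real.sqrt x| ≤ Real.pi / Real.sqrt η) ∧
    (∀ x : ℝ, -δ ≤ x → x ≤ δ → |ζ x| ≤ Real.pi / Real.sqrt δ) ∧
    (∀ x : ℝ, x ≤ -η → |ζ x| ≤ Real.log (3 + 2 * Real.sqrt 2) / Real.sqrt η) := by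
  refine ⟨fun x hx => ?_, fun x hδx hxη => ?_, fun x hδx hxδ => ?_, fun x hx => ?_⟩
  · rw [hζ]
    refine setIntegral_eq_zero_of_forall_eq_zero fun v hv => if_neg fun h => ?_
    linarith [h.2, le_abs_self v, Set.mem_Ioi.1 hv]
  · have hx : 0 < x := hδ.trans_le hδx
    rw [hζ, integral_Ioi_ite_eq (s := Set.Ioc x η), ← intervalIntegral.integral_of_le hxη,
      integral_inv_mul_sqrt_sub hx hxη, abs_sub_comm, abs_of_nonneg]
    · exact pi_div_sqrt_sub_arctan_le hx hxη
    · have := (Real.arctan_lt_pi_div_two (√(η - x) / √x)).le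
      calc 0 ≤ 2 / √x * (Real.pi / 2 - Real.arctan (√(η - x) / √x)) :=
            mul_nonneg (by positivity) (by linarith)
        _ = _ := by ring
    · refine Filter.Eventually.of_forall fun v => ⟨fun h => ⟨h.1, (le_abs_self v).trans h.2.2⟩,
        fun h => ?_⟩
      rw [abs_of_pos (hx.trans h.1)]
      exact ⟨h.1, hδx.trans h.1.le, h.2⟩
  · rw [hζ, integral_Ioi_ite_eq (s := Set.Ioc δ η), ← intervalIntegral.integral_of_le hδη]
    · calc |∫ v in δ..η, (v * √(v - x))⁻¹| ≤ ∫ v in δ..η, (v * √(v - δ))⁻¹ := by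
            rw [← Real.norm_eq_abs]
            refine intervalIntegral.norm_integral_le_of_norm_le hδη
              (Filter.Eventually.of_forall fun v hv => ?_)
              (intervalIntegrable_inv_mul_sqrt_sub hδ hδη)
            have hv0 : 0 < v := hδ.trans hv.1
            have : 0 < √(v - δ) := Real.sqrt_pos.2 (sub_pos.2 hv.1)
            rw [Real.norm_of_nonneg (by positivity)]
            gcongr
        _ = 2 / √δ * Real.arctan (√(η - δ) / √δ) := integral_inv_mul_sqrt_sub hδ hδη
        _ ≤ 2 / √δ * (Real.pi / 2) := by
            gcongr
            exact (Real.arctan_lt_pi_div_two _).le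
        _ = _ := by ring
    · filter_upwards [Measure.ae_ne volume δ] with v hv
      constructor
      · rintro ⟨h1, h2, h3⟩
        have h1 : x < v := h1
        rcases le_abs.1 h2 with h | h
        · exact ⟨lt_of_le_of_ne h hv.symm, (le_abs_self v).trans h3⟩
        · linarith
      · rintro ⟨h1, h2⟩
        rw [abs_of_pos (hδ.trans h1)]
        exact ⟨hxδ.trans_lt h1, h1.le, h2⟩
  · have hη : 0 < η := hδ.trans_le hδη
    have hxη : η ≤ -x := by linarith
    have hae : ∀ᵐ v, (v ∈ Set.Ioi x ∧ δ ≤ |v| ∧ |v| ≤ η) ↔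
        v ∈ Set.Ioc (-η) (-δ) ∪ Set.Ioc δ η := by
      filter_upwards [Measure.ae_ne volume δ, Measure.ae_ne volume (-η)] with v hv hv'
      constructor
      · rintro ⟨-, h2, h3⟩
        rw [abs_le] at h3
        rcases le_abs.1 h2 with h | h
        · exact Or.inr ⟨lt_of_le_of_ne h hv.symm, h3.2⟩
        · exact Or.inl ⟨lt_of_le_of_ne h3.1 hv'.symm, by linarith⟩
      · rintro (⟨h1, h2⟩ | ⟨h1, h2⟩)
        · rw [abs_of_neg (by linarith)]
          exact ⟨hx.trans_lt h1, by linarith, by linarith⟩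
        · rw [abs_of_pos (by linarith)]
          exact ⟨by simp only [Set.mem_Ioi]; linarith, h1.le, h2⟩
    have hneg : (fun w : ℝ => (-w * √(-w - x))⁻¹) = fun w => -(w * √(-x - w))⁻¹ := by
      funext w
      rw [neg_mul, inv_neg, neg_sub_left, sub_eq_add_neg, ← neg_add, add_comm]
    have hpos : (fun w : ℝ => (w * √(w - x))⁻¹) = fun w => (w * √(-x + w))⁻¹ := by
      funext w
      rw [neg_add_eq_sub]
    have hi1 := intervalIntegrable_inv_mul_sqrt_rev hδ hδη hxη
    have hi2 := intervalIntegrable_inv_mul_sqrt_add hδ hδη (hη.trans_le hxη)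
    have hi1' : IntervalIntegrable (fun v => (v * √(v - x))⁻¹) volume (-η) (-δ) := by
      rw [IntervalIntegrable.iff_comp_neg, neg_neg, neg_neg, hneg]
      exact hi1.neg.symm
    have hi2' : IntervalIntegrable (fun v => (v * √(v - x))⁻¹) volume δ η := by
      rwa [hpos]
    have heq : ζ x = ∫ w in δ..η, ((w * √(-x + w))⁻¹ - (w * √(-x - w))⁻¹) := by
      rw [hζ, integral_Ioi_ite_eq hae, setIntegral_union _ measurableSet_Ioc hi1'.1 hi2'.1,
        ← intervalIntegral.integral_of_le hδη, ← intervalIntegral.integral_of_le (by linarith),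
        ← intervalIntegral.integral_comp_neg, hneg, hpos, intervalIntegral.integral_neg,
        intervalIntegral.integral_sub hi2 hi1]
      · ring
      · refine Set.disjoint_left.2 fun v h1 h2 => ?_
        linarith [h1.2, h2.1]
    rw [heq, ← Real.norm_eq_abs]
    refine le_trans ?_ (integral_inv_mul_sqrt_rev_sub_add_le hδ hδη)
    refine intervalIntegral.norm_integral_le_of_norm_le hδη ?_
      ((intervalIntegrable_inv_mul_sqrt_rev hδ hδη le_rfl).sub
        (intervalIntegrable_inv_mul_sqrt_add hδ hδη hη))
    filter_upwards [Measure.ae_ne volume η] with w hw hwI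
    exact abs_inv_sqrt_add_sub_le (hδ.trans hwI.1) (lt_of_le_of_ne hwI.2 hw) hxη
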